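/- Let (X,T) and (Y,S) be elements of the Salvetti poset Sal(A,K), fix v ∈ F_Y ∩ K, and let z ∈ Z(A,K) be the class of (v,S). Then the following are equivalent: (1) T = X∘Y and S = Y∘X; (2) T = X∘Y and F_X ∩ K ⊆ K_z; (3) F_Y and F_T lie on the same side of every hyperplane H_e containing F_X, and F_X and F_S lie on the same side of every hyperplane H_e containing F_Y; (4) z ∈ U_{X,T}. -/

import Mathlib

/-- Composition of sign vectors: `(X ∘ Y) e = X e` if `X e ≠ 0`, and `Y e` otherwise. -/
def scomp {E : Type*} (X Y : E → SignType) : E → SignType :=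
  fun e => if X e = 0 then Y e else X e

/-- The partial order on sign vectors: `X ≤ Y` iff `X ∘ Y = Y`. -/
def sle {E : Type*} (X Y : E → SignType) : Prop := scomp X Y = Y

theorem sle_refl {E : Type*} (X : E → SignType) : sle X X := by
  funext e; show (if X e = 0 then X e else X e) = X e; split <;> rfl

theorem sle_trans {E : Type*} {X Y Z : E → SignType} (h₁ : sle X Y) (h₂ : sle Y Z) :
    sle X Z := by
  funext e
  have h1 := congrFun h₁ e
  have h2 := congrFun h₂ e
  revert h1 h2
  show (if X e = 0 then Y e else X e) = Y e → (if Y e = 0 then Z e else Y e) = Z e →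
    (if X e = 0 then Z e else X e) = Z e
  generalize X e = a; generalize Y e = b; generalize Z e = c
  revert a b c; decide

theorem sle_antisymm {E : Type*} {X Y : E → SignType} (h₁ : sle X Y) (h₂ : sle Y X) :
    X = Y := by
  funext e
  have h1 := congrFun h₁ e
  have h2 := congrFun h₂ e
  revert h1 h2
  show (if X e = 0 then Y e else X e) = Y e → (if Y e = 0 then X e else Y e) = X e → X e = Y e
  generalize X e = a; generalize Y e = b
  revert a b; decide

/-- The separating set of two sign vectors: the indices where they take opposite
nonzero signs. -/
def SepSet {E : Type*} (X Y : E → SignType) : Set E :=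
  {e | (X e = 1 ∧ Y e = -1) ∨ (X e = -1 ∧ Y e = 1)}

section Geometry

variable {E : Type*} {V : Type*} [NormedAddCommGroup V] [NormedSpace ℝ V]

/-- The face of a sign vector `X`, relative to the family of cooriented affine hyperplanes
`H_e = {v | f e v = 0}`, with positive side `H_e⁺ = {v | f e v > 0}` and negative side
`H_e⁻ = {v | f e v < 0}`. -/
def face (f : E → (V →ᵃ[ℝ] ℝ)) (X : E → SignType) : Set V :=
  {v | ∀ e, SignType.sign (f e v) = X e}

/-- The conditional oriented matroid `L(A,K)`: the set of sign vectors whose face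
meets `K`. -/
def covs (f : E → (V →ᵃ[ℝ] ℝ)) (K : Set V) : Set (E → SignType) :=
  {X | (face f X ∩ K).Nonempty}

/-- A tope of `L(A,K)`: a maximal covector. -/
def IsTope (f : E → (V →ᵃ[ℝ] ℝ)) (K : Set V) (T : E → SignType) : Prop :=
  T ∈ covs f K ∧ ∀ Y ∈ covs f K, sle T Y → Y = T

/-- The set of topes of `L(A,K)`, as a type carrying the discrete topology. -/
def Topes (f : E → (V →ᵃ[ℝ] ℝ)) (K : Set V) : Type _ := {T : E → SignType // IsTope f K T}

instance (f : E → (V →ᵃ[ℝ] ℝ)) (K : Set V) : TopologicalSpace (Topes f K) := ⊥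

instance (f : E → (V →ᵃ[ℝ] ℝ)) (K : Set V) : DiscreteTopology (Topes f K) := ⟨rfl⟩

/-- Points of `K × T(A,K)`. -/
abbrev ZPre (f : E → (V →ᵃ[ℝ] ℝ)) (K : Set V) : Type _ := K × Topes f K

/-- The gluing relation defining `Z(A,K)`: `(v,T) ∼ (v',T')` iff `v = v'` and `v` lies on
no hyperplane separating `T` from `T'`. -/
def ZRel (f : E → (V →ᵃ[ℝ] ℝ)) (K : Set V) : ZPre f K → ZPre f K → Prop :=
  fun p q => (p.1 : V) = (q.1 : V) ∧ ∀ e ∈ SepSet p.2.1 q.2.1, f e (p.1 : V) ≠ 0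

/-- The space `Z(A,K)`: one copy of `K` for each tope, glued along the complement of the
separating hyperplanes, with the quotient topology. -/
def ZSpace (f : E → (V →ᵃ[ℝ] ℝ)) (K : Set V) : Type _ := Quot (ZRel f K)

instance (f : E → (V →ᵃ[ℝ] ℝ)) (K : Set V) : TopologicalSpace (ZSpace f K) :=
  inferInstanceAs (TopologicalSpace (Quot (ZRel f K)))

/-- The projection `π : Z(A,K) → V` (with image `K`), sending `[(v,T)]` to `v`. -/
def Zproj (f : E → (V →ᵃ[ℝ] ℝ)) (K : Set V) : ZSpace f K → V :=
  Quot.lift (fun p => (p.1 : V)) (fun _ _ h => h.1)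

/-- The set `K_{X,T} = K ∩ ⋂_{e : X_e = 0} H_e^{T_e}`. -/
def KXT (f : E → (V →ᵃ[ℝ] ℝ)) (K : Set V) (X T : E → SignType) : Set V :=
  K ∩ ⋂ e ∈ {e | X e = 0}, {v | SignType.sign (f e v) = T e}

/-- The subset `U_{X,T} ⊆ Z(A,K)`: the image of `K_{X,T} × {T}` under the quotient map. -/
def UXT (f : E → (V →ᵃ[ℝ] ℝ)) (K : Set V) (X : E → SignType) (T : Topes f K) :
    Set (ZSpace f K) :=
  {z | ∃ (v : V) (hv : v ∈ K), v ∈ KXT f K X T.1 ∧ z = Quot.mk (ZRel f K) (⟨v, hv⟩, T)}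

/-- The complexified complement `M(A,K)`, where `V ⊗ ℂ` is modeled as `V × V` (real and
imaginary parts): `v + iw` lies on `H_e ⊗ ℂ` iff `f e v = 0` and the linear part of `f e`
vanishes on `w`. -/
def MSpace (f : E → (V →ᵃ[ℝ] ℝ)) (K : Set V) : Type _ :=
  {p : V × V // p.1 ∈ K ∧ ∀ e, ¬(f e p.1 = 0 ∧ (f e).linear p.2 = 0)}

instance (f : E → (V →ᵃ[ℝ] ℝ)) (K : Set V) : TopologicalSpace (MSpace f K) :=
  inferInstanceAs (TopologicalSpace {p : V × V // p.1 ∈ K ∧ _})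

/-- The projection `ρ : M(A,K) → V` (with image `K`), sending `v + iw` to `v`. -/
def Mproj (f : E → (V →ᵃ[ℝ] ℝ)) (K : Set V) : MSpace f K → V := fun p => p.1.1

end Geometry

theorem sle_iff {E : Type*} {X Y : E → SignType} : sle X Y ↔ ∀ e, X e ≠ 0 → Y e = X e := by
  simp only [sle, scomp, funext_iff]
  grind

theorem sle.eq_scomp_iff {E : Type*} {X Y T : E → SignType} (h : sle X T) :
    T = scomp X Y ↔ ∀ e, X e = 0 → T e = Y e := by
  rw [sle_iff] at h
  simp only [scomp, funext_iff]
  grind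

theorem mem_SepSet_of_ne {E : Type*} {S T : E → SignType} {e : E} (hS : S e ≠ 0) (hT : T e ≠ 0)
    (h : S e ≠ T e) : e ∈ SepSet S T := by
  simp only [SepSet, Set.mem_ofPred_eq]
  revert hS hT h
  generalize S e = a
  generalize T e = b
  revert a b
  decide

theorem ne_of_mem_SepSet {E : Type*} {S T : E → SignType} {e : E} (h : e ∈ SepSet S T) :
    S e ≠ T e := by
  rcases h with ⟨h₁, h₂⟩ | ⟨h₁, h₂⟩ <;> rw [h₁, h₂] <;> decide

section Topes

variable {E : Type*} {V : Type*} [NormedAddCommGroup V] [NormedSpace ℝ V]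

/-- The topes of an arrangement of hyperplanes restricted to an open set have no zero entry. -/
theorem IsTope.ne_zero [Finite E] {f : E → (V →ᵃ[ℝ] ℝ)} (hf : ∀ e, (f e).linear ≠ 0)
    {K : Set V} (hK : IsOpen K) {T : E → SignType} (hT : IsTope f K T) (e : E) : T e ≠ 0 := by
  intro hTe
  obtain ⟨⟨w, hwT, hwK⟩, hmax⟩ := hT
  obtain ⟨u, hu⟩ : ∃ u, (f e).linear u ≠ 0 := by
    by_contra! h
    exact hf e (LinearMap.ext h)
  have happ : ∀ i (t : ℝ), f i (t • u + w) = t * (f i).linear u + f i w := fun i t => by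
    simpa using (f i).map_vadd w (t • u)
  have hnear : ∀ᶠ t : ℝ in nhds 0, t • u + w ∈ K ∧
      ∀ i, f i w ≠ 0 → SignType.sign (f i (t • u + w)) = SignType.sign (f i w) := by
    refine Filter.Eventually.and ?_ (Filter.eventually_all.2 fun i => ?_)
    · have hc : ContinuousAt (fun t : ℝ => t • u + w) 0 := by fun_prop
      exact hc.eventually_mem (hK.mem_nhds (by simpa using hwK))
    · have hc : Filter.Tendsto (fun t : ℝ => f i (t • u + w)) (nhds 0) (nhds (f i w)) := by
        simp only [happ]
        exact Continuous.tendsto' (by fun_prop) _ _ (by simp)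
      rcases lt_trichotomy (f i w) 0 with h | h | h
      · filter_upwards [hc.eventually_lt_const h] with t ht _
        rw [sign_neg ht, sign_neg h]
      · exact Filter.Eventually.of_forall fun t h' => absurd h h'
      · filter_upwards [hc.eventually_const_lt h] with t ht _
        rw [sign_pos ht, sign_pos h]
  obtain ⟨t, ⟨htK, hts⟩, ht0⟩ := ((hnear.filter_mono nhdsWithin_le_nhds).and
    (self_mem_nhdsWithin : {(0 : ℝ)}ᶜ ∈ nhdsWithin 0 {0}ᶜ)).exists
  have heq := hmax (fun i => SignType.sign (f i (t • u + w))) ⟨_, fun _ => rfl, htK⟩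
    (sle_iff.2 fun i hi => by
      rw [← hwT i] at hi ⊢
      exact hts i (sign_ne_zero.1 hi))
  have hw0 : f e w = 0 := sign_eq_zero_iff.1 ((hwT e).trans hTe)
  have h0 := (congrFun heq e).trans hTe
  rw [sign_eq_zero_iff, happ, hw0, add_zero] at h0
  exact (mul_ne_zero ht0 hu) h0

/-- Two points of `K × T(A,K)` have the same class in `Z(A,K)` iff they are related by the gluing
relation, provided that topes have no zero entry. -/
theorem quot_mk_ZRel_eq_iff {f : E → (V →ᵃ[ℝ] ℝ)} {K : Set V}
    (h0 : ∀ T : Topes f K, ∀ e, T.1 e ≠ 0) {p q : ZPre f K} :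
    Quot.mk (ZRel f K) p = Quot.mk (ZRel f K) q ↔
      p.1 = q.1 ∧ ∀ e, f e p.1 = 0 → p.2.1 e = q.2.1 e := by
  refine ⟨fun h => ?_, fun ⟨h₁, h₂⟩ => Quot.sound ⟨congrArg _ h₁, fun e he hz =>
    ne_of_mem_SepSet he (h₂ e hz)⟩⟩
  let r : ZPre f K → ZPre f K → Prop := fun p q =>
    p.1 = q.1 ∧ ∀ e, f e p.1 = 0 → p.2.1 e = q.2.1 e
  have hr : Equivalence r :=
    { refl := fun _ => ⟨rfl, fun _ _ => rfl⟩
      symm := fun h => ⟨h.1.symm, fun e he => (h.2 e (h.1 ▸ he)).symm⟩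
      trans := fun h h' => ⟨h.1.trans h'.1, fun e he => (h.2 e he).trans (h'.2 e (h.1 ▸ he))⟩ }
  exact hr.eqvGen_iff.1 ((Quot.eqvGen_exact h).mono fun p q hpq =>
    ⟨Subtype.ext hpq.1, fun e he => by
      by_contra hne
      exact hpq.2 e (mem_SepSet_of_ne (h0 _ e) (h0 _ e) hne) he⟩)

theorem mk_mem_UXT_iff {f : E → (V →ᵃ[ℝ] ℝ)} {K : Set V} {X : E → SignType} {T : Topes f K}
    (h0 : ∀ T : Topes f K, ∀ e, T.1 e ≠ 0) {p : ZPre f K} :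
    (Quot.mk (ZRel f K) p : ZSpace f K) ∈ UXT f K X T ↔
      (∀ e, X e = 0 → SignType.sign (f e p.1) = T.1 e) ∧
        ∀ e, f e p.1 = 0 → p.2.1 e = T.1 e := by
  have hKXT : ∀ v, v ∈ KXT f K X T.1 ↔ v ∈ K ∧ ∀ e, X e = 0 → SignType.sign (f e v) = T.1 e := by
    simp [KXT]
  constructor
  · rintro ⟨v, hv, hvX, heq⟩
    obtain ⟨h₁, h₂⟩ := (quot_mk_ZRel_eq_iff h0).1 heq
    refine ⟨?_, h₂⟩
    rw [h₁]
    exact ((hKXT v).1 hvX).2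
  · rintro ⟨h₁, h₂⟩
    exact ⟨p.1, p.1.2, (hKXT _).2 ⟨p.1.2, h₁⟩, (quot_mk_ZRel_eq_iff h0).2 ⟨rfl, h₂⟩⟩

theorem face_subset_hyperplane_iff {f : E → (V →ᵃ[ℝ] ℝ)} {X : E → SignType}
    (hX : (face f X).Nonempty) {e : E} : face f X ⊆ {w | f e w = 0} ↔ X e = 0 := by
  obtain ⟨x, hx⟩ := hX
  exact ⟨fun h => by rw [← hx e, sign_eq_zero_iff]; exact h hx,
    fun h w hw => sign_eq_zero_iff.1 ((hw e).trans h)⟩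

theorem face_subset_pos_iff {f : E → (V →ᵃ[ℝ] ℝ)} {X : E → SignType}
    (hX : (face f X).Nonempty) {e : E} : face f X ⊆ {w | 0 < f e w} ↔ X e = 1 := by
  obtain ⟨x, hx⟩ := hX
  exact ⟨fun h => by rw [← hx e, sign_eq_one_iff]; exact h hx,
    fun h w hw => sign_eq_one_iff.1 ((hw e).trans h)⟩

theorem face_subset_neg_iff {f : E → (V →ᵃ[ℝ] ℝ)} {X : E → SignType}
    (hX : (face f X).Nonempty) {e : E} : face f X ⊆ {w | f e w < 0} ↔ X e = -1 := by
  obtain ⟨x, hx⟩ := hX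
  exact ⟨fun h => by rw [← hx e, sign_eq_neg_one_iff]; exact h hx,
    fun h w hw => sign_eq_neg_one_iff.1 ((hw e).trans h)⟩

/-- A face and the face of a sign vector nonzero at `e` lie on the same side of `H_e` iff their
signs at `e` agree. -/
theorem faces_same_side_iff {f : E → (V →ᵃ[ℝ] ℝ)} {Y T : E → SignType}
    (hY : (face f Y).Nonempty) (hT : (face f T).Nonempty) {e : E} (h0 : T e ≠ 0) :
    ((face f Y ⊆ {w | 0 < f e w} ∧ face f T ⊆ {w | 0 < f e w}) ∨
      (face f Y ⊆ {w | f e w < 0} ∧ face f T ⊆ {w | f e w < 0})) ↔ T e = Y e := by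
  rw [face_subset_pos_iff hY, face_subset_pos_iff hT, face_subset_neg_iff hY,
    face_subset_neg_iff hT]
  revert h0
  generalize Y e = a
  generalize T e = b
  revert a b
  decide

theorem face_inter_subset_KXT_iff {f : E → (V →ᵃ[ℝ] ℝ)} {K : Set V} {X Y S : E → SignType}
    (hX : X ∈ covs f K) : face f X ∩ K ⊆ KXT f K Y S ↔ ∀ e, Y e = 0 → S e = X e := by
  simp only [KXT, Set.subset_def, Set.mem_inter_iff, Set.mem_iInter, Set.mem_ofPred_eq]
  obtain ⟨x, hx, hxK⟩ := hX
  exact ⟨fun h e he => by rw [← (h x ⟨hx, hxK⟩).2 e he, hx e],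
    fun h w hw => ⟨hw.2, fun e he => by rw [hw.1 e, h e he]⟩⟩

end Topes

variable {V : Type*} [NormedAddCommGroup V] [NormedSpace ℝ V] [FiniteDimensional ℝ V]
variable {E : Type*} [Fintype E]

/-- Let `(X,T)` and `(Y,S)` be elements of the Salvetti poset `Sal(A,K)`, fix
`v ∈ F_Y ∩ K`, and let `z ∈ Z(A,K)` be the class of `(v,S)`.  The following are
equivalent:
1. `T = X∘Y` and `S = Y∘X`;
2. `T = X∘Y` and `F_X ∩ K ⊆ K_z` (where `K_z = K_{Y,S}`);
3. `F_Y` and `F_T` lie on the same side of every hyperplane containing `F_X`, and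
   `F_X` and `F_S` lie on the same side of every hyperplane containing `F_Y`;
4. `z ∈ U_{X,T}`. -/
theorem salvetti_membership_tfae
    (f : E → (V →ᵃ[ℝ] ℝ)) (hf : ∀ e, (f e).linear ≠ 0)
    (K : Set V) (hKne : K.Nonempty) (hKconv : Convex ℝ K) (hKopen : IsOpen K)
    (X T Y S : E → SignType)
    (hX : X ∈ covs f K) (hT : IsTope f K T) (hXT : sle X T)
    (hY : Y ∈ covs f K) (hS : IsTope f K S) (hYS : sle Y S)
    (v : V) (hvY : v ∈ face f Y) (hvK : v ∈ K) :
    List.TFAE [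
      T = scomp X Y ∧ S = scomp Y X,
      T = scomp X Y ∧ face f X ∩ K ⊆ KXT f K Y S,
      (∀ e, face f X ⊆ {w | f e w = 0} →
        ((face f Y ⊆ {w | 0 < f e w} ∧ face f T ⊆ {w | 0 < f e w}) ∨
          (face f Y ⊆ {w | f e w < 0} ∧ face f T ⊆ {w | f e w < 0}))) ∧
      (∀ e, face f Y ⊆ {w | f e w = 0} →
        ((face f X ⊆ {w | 0 < f e w} ∧ face f S ⊆ {w | 0 < f e w}) ∨
          (face f X ⊆ {w | f e w < 0} ∧ face f S ⊆ {w | f e w < 0}))),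
      Quot.mk (ZRel f K) (⟨v, hvK⟩, ⟨S, hS⟩) ∈ UXT f K X ⟨T, hT⟩] := by
  have hT0 := hT.ne_zero hf hKopen
  have hS0 := hS.ne_zero hf hKopen
  have hXne : (face f X).Nonempty := hX.mono Set.inter_subset_left
  have hYne : (face f Y).Nonempty := hY.mono Set.inter_subset_left
  have hTne : (face f T).Nonempty := hT.1.mono Set.inter_subset_left
  have hSne : (face f S).Nonempty := hS.1.mono Set.inter_subset_left
  rw [hXT.eq_scomp_iff, hYS.eq_scomp_iff, face_inter_subset_KXT_iff hX]
  simp only [face_subset_hyperplane_iff hXne, face_subset_hyperplane_iff hYne,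
    faces_same_side_iff hYne hTne (hT0 _), faces_same_side_iff hXne hSne (hS0 _)]
  tfae_have 1 ↔ 2 := Iff.rfl
  tfae_have 1 ↔ 3 := Iff.rfl
  tfae_have 1 ↔ 4 := by
    have hz : ∀ e, f e v = 0 ↔ Y e = 0 := fun e => by rw [← hvY e, sign_eq_zero_iff]
    rw [sle_iff] at hXT
    refine Iff.trans ?_ (mk_mem_UXT_iff fun T => T.2.ne_zero hf hKopen).symm
    simp only [hvY _, hz, eq_comm (a := Y _)]
    refine and_congr_right fun h => forall₂_congr fun e he => ?_
    rw [hXT e fun hXe => hT0 e ((h e hXe).trans he.symm)]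
  tfae_finish
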